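/- arXiv:2211.04674 — 13 statements merged into one kernel-verified Lean document; each statement's English description precedes it below -/
import Mathlib

section
/- Consider the shortest-path instance consisting of two vertices s and t joined by two parallel edges e₀ and e₁, so that a weight vector is a pair w : Fin 2 → ℝ of nonnegative reals and a deterministic algorithm is a function A from nonnegative weight vectors to Fin 2 (the index of the edge it outputs). Suppose A has a finite approximation ratio, i.e. there exists C ≥ 1 such that for every nonnegative w, w(A(w)) ≤ C · min(w 0, w 1). Then A is not Lipschitz continuous: for every L > 0 there exist nonnegative weight vectors w, w' such that d_w(A, w, w') > L · (|w 0 − w' 0| + |w 1 − w' 1|), where d_w(A, w, w') := |w(A(w)) − w'(A(w))| if A(w) = A(w'), and d_w(A, w, w') := w(A(w)) + w'(A(w')) if A(w) ≠ A(w'). -/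
/-- Any deterministic algorithm for the two-parallel-edge shortest-path
instance with a finite approximation ratio is not Lipschitz continuous. -/
theorem shortestPath_deterministic_not_lipschitz
    (A : (Fin 2 → ℝ) → Fin 2)
    (happrox : ∃ C : ℝ, 1 ≤ C ∧ ∀ w : Fin 2 → ℝ, (∀ i, 0 ≤ w i) →
      w (A w) ≤ C * min (w 0) (w 1)) :
    ∀ L : ℝ, 0 < L → ∃ w w' : Fin 2 → ℝ, (∀ i, 0 ≤ w i) ∧ (∀ i, 0 ≤ w' i) ∧
      L * (|w 0 - w' 0| + |w 1 - w' 1|) <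
        (if A w = A w' then |w (A w) - w' (A w)| else w (A w) + w' (A w')) := by
  intro L hL
  obtain ⟨C, hC, hA⟩ := happrox
  by_contra! hLip
  have hpos : ∀ k : ℕ, 0 ≤ 1 / (C + 1) + k * (1 / (2 * L)) := fun k => by positivity
  -- Start where edge `1` is forced, then raise its weight in steps of `1 / (2 * L)`.
  have hstay : ∀ n : ℕ, A ![1, 1 / (C + 1) + n * (1 / (2 * L))] = 1 := by
    intro n
    induction n with
    | zero =>
      by_contra hne
      have hzero := (by decide : ∀ i : Fin 2, i ≠ 1 → i = 0) _ hne
      have hcost := hA ![1, 1 / (C + 1) + (0 : ℕ) * (1 / (2 * L))]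
        (Fin.forall_fin_two.2 ⟨zero_le_one, hpos 0⟩)
      rw [hzero] at hcost
      have hmin := hcost.trans (mul_le_mul_of_nonneg_left (min_le_right _ _) (by linarith))
      simp only [Matrix.cons_val_zero, Matrix.cons_val_one, Nat.cast_zero, zero_mul,
        add_zero] at hmin
      rw [mul_one_div, le_div_iff₀ (by linarith)] at hmin
      linarith
    | succ n ih =>
      by_contra hne
      have hzero := (by decide : ∀ i : Fin 2, i ≠ 1 → i = 0) _ hne
      have hstep := hLip ![1, 1 / (C + 1) + n * (1 / (2 * L))]
        ![1, 1 / (C + 1) + (n + 1 : ℕ) * (1 / (2 * L))]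
        (Fin.forall_fin_two.2 ⟨zero_le_one, hpos n⟩)
        (Fin.forall_fin_two.2 ⟨zero_le_one, hpos (n + 1)⟩)
      rw [ih, hzero, if_neg (by decide)] at hstep
      have hdiff : |1 / (C + 1) + n * (1 / (2 * L)) -
          (1 / (C + 1) + (n + 1 : ℕ) * (1 / (2 * L)))| = 1 / (2 * L) := by
        rw [abs_sub_comm, abs_of_nonneg] <;> push_cast <;> ring_nf
        positivity
      simp only [Matrix.cons_val_zero, Matrix.cons_val_one, sub_self, abs_zero, zero_add,
        hdiff] at hstep
      have hhalf : L * (1 / (2 * L)) = 1 / 2 := by field_simp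
      linarith [hpos n]
  obtain ⟨n, hn⟩ := exists_nat_gt (C / (1 / (2 * L)))
  rw [div_lt_iff₀ (by positivity)] at hn
  have hinv : 0 < 1 / (C + 1) := by positivity
  have hcost := hA ![1, 1 / (C + 1) + n * (1 / (2 * L))]
    (Fin.forall_fin_two.2 ⟨zero_le_one, hpos n⟩)
  rw [hstay n] at hcost
  have hmin := hcost.trans (mul_le_mul_of_nonneg_left (min_le_left _ _) (by linarith))
  simp only [Matrix.cons_val_zero, Matrix.cons_val_one, mul_one] at hmin
  linarith
end

section
/- Let E be a finite type, let c > 0 and L > 0, and let D : (E → ℝ) → (E → ℝ) → ℝ be a function satisfying: (i) D(u,u) = 0 for all u; (ii) symmetry D(u,v) = D(v,u); and (iii) the triangle inequality D(u,v) ≤ D(u,x) + D(x,v) for all u, v, x. Suppose that for every w : E → ℝ with w ≥ 0, every f ∈ E, and every δ with 0 < δ ≤ c, one has D(w, w + δ·𝟙_f) ≤ δ·L, where 𝟙_f is the indicator vector of the coordinate f. Then for all nonnegative w, w' : E → ℝ, D(w, w') ≤ L · Σ_{e ∈ E} |w(e) − w'(e)|. -/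
open Function in
/-- A bound on `D` for small increases of one coordinate holds for increases of any size. -/
theorem update_add_le_of_small_step {E : Type*} [DecidableEq E] {c L : ℝ} (hc : 0 < c)
    {D : (E → ℝ) → (E → ℝ) → ℝ}
    (hrefl : ∀ u : E → ℝ, D u u = 0)
    (htriangle : ∀ u v x : E → ℝ, D u v ≤ D u x + D x v)
    (hstep : ∀ w : E → ℝ, (∀ e, 0 ≤ w e) → ∀ f : E, ∀ δ : ℝ, 0 < δ → δ ≤ c →
      D w (update w f (w f + δ)) ≤ δ * L)
    {w : E → ℝ} (hw : ∀ e, 0 ≤ w e) (f : E) {δ : ℝ} (hδ : 0 ≤ δ) :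
    D w (update w f (w f + δ)) ≤ δ * L := by
  obtain ⟨n, hn⟩ := exists_nat_ge (δ / c)
  rw [div_le_iff₀ hc] at hn
  induction n generalizing w δ with
  | zero =>
    obtain rfl : δ = 0 := le_antisymm (by simpa using hn) hδ
    simp [hrefl]
  | succ n ih =>
    rcases hδ.eq_or_lt with rfl | hpos
    · simp [hrefl]
    rcases le_or_gt δ c with hle | hlt
    · exact hstep w hw f δ hpos hle
    have hu : ∀ e, 0 ≤ update w f (w f + c) e := by
      intro e
      rcases eq_or_ne e f with rfl | he
      · simpa using add_nonneg (hw e) hc.le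
      · simpa [he] using hw e
    have h₁ := hstep w hw f c hc le_rfl
    have h₂ := ih hu (sub_nonneg.2 hlt.le) (by push_cast at hn; linarith)
    have heq : w f + c + (δ - c) = w f + δ := by ring
    rw [update_self, update_idem, heq] at h₂
    linarith [htriangle w (update w f (w f + δ)) (update w f (w f + c))]

open Function in
/-- A bound on `D` for increases of one coordinate extends to arbitrary changes of it. -/
theorem update_le_of_update_add_le {E : Type*} [DecidableEq E] {L : ℝ}
    {D : (E → ℝ) → (E → ℝ) → ℝ}
    (hsymm : ∀ u v : E → ℝ, D u v = D v u)
    (hadd : ∀ w : E → ℝ, (∀ e, 0 ≤ w e) → ∀ f : E, ∀ δ : ℝ, 0 ≤ δ →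
      D w (update w f (w f + δ)) ≤ δ * L)
    {w : E → ℝ} (hw : ∀ e, 0 ≤ w e) (f : E) {a : ℝ} (ha : 0 ≤ a) :
    D w (update w f a) ≤ L * |w f - a| := by
  rcases le_total (w f) a with h | h
  · have := hadd w hw f (a - w f) (sub_nonneg.2 h)
    rw [add_sub_cancel] at this
    rw [abs_sub_comm, abs_of_nonneg (sub_nonneg.2 h)]
    linarith
  · have hu : ∀ e, 0 ≤ update w f a e := by
      intro e
      rcases eq_or_ne e f with rfl | he
      · simpa using ha
      · simpa [he] using hw e
    have := hadd _ hu f (w f - a) (sub_nonneg.2 h)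
    rw [update_self, update_idem, add_sub_cancel, update_eq_self] at this
    rw [hsymm, abs_of_nonneg (sub_nonneg.2 h)]
    linarith

/-- Changing the coordinates in `s` one at a time bounds `D` by the total change on `s`. -/
theorem piecewise_le_of_update_le {E : Type*} [DecidableEq E] {L : ℝ}
    {D : (E → ℝ) → (E → ℝ) → ℝ}
    (hrefl : ∀ u : E → ℝ, D u u = 0)
    (htriangle : ∀ u v x : E → ℝ, D u v ≤ D u x + D x v)
    (hupdate : ∀ w : E → ℝ, (∀ e, 0 ≤ w e) → ∀ f : E, ∀ a : ℝ, 0 ≤ a →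
      D w (Function.update w f a) ≤ L * |w f - a|)
    {w w' : E → ℝ} (hw : ∀ e, 0 ≤ w e) (hw' : ∀ e, 0 ≤ w' e) (s : Finset E) :
    D w (s.piecewise w' w) ≤ L * ∑ e ∈ s, |w e - w' e| := by
  induction s using Finset.induction_on with
  | empty => simp [hrefl]
  | insert f s hf ih =>
    have hu : ∀ e, 0 ≤ s.piecewise w' w e := fun e =>
      s.piecewise_cases w' w (fun x => 0 ≤ x) (hw' e) (hw e)
    have h := hupdate _ hu f (w' f) (hw' f)
    rw [Finset.piecewise_eq_of_notMem s w' w hf] at h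
    rw [Finset.piecewise_insert, Finset.sum_insert hf, mul_add]
    linarith [htriangle w (Function.update (s.piecewise w' w) f (w' f)) (s.piecewise w' w)]


/-- To bound the Lipschitz constant of an algorithm with respect to a metric `D`
on weight vectors, it suffices to consider pairs of weight vectors that differ
in a single coordinate by a small amount `δ ≤ c`. -/
theorem lipschitz_from_single_coordinate_perturbations
    {E : Type*} [Fintype E] [DecidableEq E] (c L : ℝ) (hc : 0 < c) (hL : 0 < L)
    (D : (E → ℝ) → (E → ℝ) → ℝ)
    (hrefl : ∀ u : E → ℝ, D u u = 0)
    (hsymm : ∀ u v : E → ℝ, D u v = D v u)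
    (htriangle : ∀ u v x : E → ℝ, D u v ≤ D u x + D x v)
    (hstep : ∀ w : E → ℝ, (∀ e, 0 ≤ w e) → ∀ f : E, ∀ δ : ℝ, 0 < δ → δ ≤ c →
      D w (fun e => w e + if e = f then δ else 0) ≤ δ * L) :
    ∀ w w' : E → ℝ, (∀ e, 0 ≤ w e) → (∀ e, 0 ≤ w' e) →
      D w w' ≤ L * ∑ e, |w e - w' e| := by
  intro w w' hw hw'
  have hstep' : ∀ w : E → ℝ, (∀ e, 0 ≤ w e) → ∀ f : E, ∀ δ : ℝ, 0 < δ → δ ≤ c →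
      D w (Function.update w f (w f + δ)) ≤ δ * L := by
    intro w hw f δ hδ hδc
    convert hstep w hw f δ hδ hδc using 2
    ext e
    rcases eq_or_ne e f with rfl | he <;> simp [*]
  have h := piecewise_le_of_update_le hrefl htriangle
    (fun _ hv f _ ha => update_le_of_update_add_le hsymm
      (fun _ hu g _ hδ => update_add_le_of_small_step hc hrefl htriangle hstep' hu g hδ) hv f ha)
    hw hw' Finset.univ
  rwa [Finset.piecewise_univ] at h
end

section
/- Let G be a connected simple graph on a finite vertex type V, let f be an edge of G, let δ > 0, and let w : Sym2 V → ℝ be nonnegative such that both w and w + δ·𝟙_f restricted to the edge set of G are injective. Let T = T(w) and T^{δf} = T(w + δ·𝟙_f) denote the (unique) minimum spanning trees with respect to w and w + δ·𝟙_f, respectively. Then either T^{δf} = T, or T^{δf} is obtained from T by deleting f and adding a single edge g of G with w(g) ≤ w(f) + δ, i.e. T^{δf} = (T \ {f}) ∪ {g}. -/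
/-- `T` is a minimum spanning tree of `G` with respect to the weights `w`:
its edges are edges of `G`, it forms a connected acyclic graph on `V`, and it has
minimum total weight among all such edge sets. -/
def IsMinSpanningTree {V : Type*} [Fintype V] (G : SimpleGraph V)
    (w : Sym2 V → ℝ) (T : Finset (Sym2 V)) : Prop :=
  (↑T : Set (Sym2 V)) ⊆ G.edgeSet ∧
  (SimpleGraph.fromEdgeSet (↑T : Set (Sym2 V))).Connected ∧
  (SimpleGraph.fromEdgeSet (↑T : Set (Sym2 V))).IsAcyclic ∧
  ∀ T' : Finset (Sym2 V), (↑T' : Set (Sym2 V)) ⊆ G.edgeSet →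
    (SimpleGraph.fromEdgeSet (↑T' : Set (Sym2 V))).Connected →
    (SimpleGraph.fromEdgeSet (↑T' : Set (Sym2 V))).IsAcyclic →
    ∑ e ∈ T, w e ≤ ∑ e ∈ T', w e

open SimpleGraph in
/-- Replacing an edge `e` of a tree by an edge joining two vertices that are separated by the
removal of `e` gives a tree. -/
theorem SimpleGraph.IsTree.deleteEdges_sup_edge {V : Type*} {H : SimpleGraph V} (hH : H.IsTree)
    {e : Sym2 V} {u v : V} (huv : ¬ (H.deleteEdges {e}).Reachable u v) :
    (H.deleteEdges {e} ⊔ edge u v).IsTree := by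
  have hne : u ≠ v := fun h => huv (h ▸ Reachable.rfl)
  refine ⟨?_, (hH.isAcyclic.anti (deleteEdges_le _)).sup_edge_of_not_reachable huv⟩
  induction e with | h a b
  -- every vertex stays connected to one of the endpoints of the deleted edge
  have key : ∀ x, (H.deleteEdges {s(a, b)}).Reachable a x ∨
      (H.deleteEdges {s(a, b)}).Reachable b x := by
    intro x
    obtain ⟨p⟩ := hH.connected.preconnected x a
    induction p with
    | nil => exact Or.inl Reachable.rfl
    | @cons x y z hxy p ih =>
      by_cases hxe : s(x, y) = s(z, b)
      · rcases Sym2.eq_iff.mp hxe with ⟨rfl, -⟩ | ⟨rfl, -⟩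
        · exact Or.inl Reachable.rfl
        · exact Or.inr Reachable.rfl
      · have hyx : (H.deleteEdges {s(z, b)}).Reachable y x :=
          (deleteEdges_adj.mpr ⟨hxy, hxe⟩ : (H.deleteEdges {s(z, b)}).Adj x y).reachable.symm
        exact (ih huv).imp (·.trans hyx) (·.trans hyx)
  have huv' : (H.deleteEdges {s(a, b)} ⊔ edge u v).Reachable u v :=
    Adj.reachable (Or.inr (by simp [edge_adj, hne]))
  have mono : ∀ {x y}, (H.deleteEdges {s(a, b)}).Reachable x y →
      (H.deleteEdges {s(a, b)} ⊔ edge u v).Reachable x y := fun h => h.mono le_sup_left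
  have hu : ∀ x, (H.deleteEdges {s(a, b)} ⊔ edge u v).Reachable u x := by
    intro x
    rcases key u with h1 | h1 <;> rcases key v with h2 | h2 <;> rcases key x with h3 | h3
    all_goals first
      | exact (huv (h1.symm.trans h2)).elim
      | exact mono (h1.symm.trans h3)
      | exact huv'.trans (mono (h2.symm.trans h3))
  have := hH.connected.nonempty
  exact ⟨fun x y => (hu x).symm.trans (hu y)⟩

open SimpleGraph in
/-- Symmetric exchange property of spanning trees. -/
theorem SimpleGraph.IsTree.exists_symmetric_exchange {V : Type*} {S T : Set (Sym2 V)}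
    (hS : (fromEdgeSet S).IsTree) (hT : (fromEdgeSet T).IsTree) {e : Sym2 V}
    (heS : e ∈ S) (heT : e ∉ T) (he : ¬ e.IsDiag) :
    ∃ g ∈ T, g ∉ S ∧ (fromEdgeSet (insert g (S \ {e}))).IsTree ∧
      (fromEdgeSet (insert e (T \ {g}))).IsTree := by
  have swap : ∀ {U : Set (Sym2 V)} {a b : V} {d : Sym2 V}, (fromEdgeSet U).IsTree →
      ¬ ((fromEdgeSet U).deleteEdges {d}).Reachable a b →
      (fromEdgeSet (insert s(a, b) (U \ {d}))).IsTree := by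
    intro U a b d hU hab
    have h := hU.deleteEdges_sup_edge hab
    rwa [deleteEdges_fromEdgeSet, edge, ← fromEdgeSet_union, Set.union_singleton] at h
  induction e with | h u v
  have hbridge : ¬ ((fromEdgeSet S).deleteEdges {s(u, v)}).Reachable u v :=
    isAcyclic_iff_forall_adj_isBridge.mp hS.isAcyclic
      (fromEdgeSet_adj S |>.mpr ⟨heS, by simpa using he⟩)
  obtain ⟨p, hp⟩ := hT.connected.exists_isPath u v
  obtain ⟨⟨⟨a, b⟩, hab⟩, hd, ha, hb⟩ := p.exists_boundary_dart
    {x | ((fromEdgeSet S).deleteEdges {s(u, v)}).Reachable u x} Reachable.rfl hbridge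
  simp only [Set.mem_ofPred_eq] at ha hb
  have hpe : s(a, b) ∈ p.edges := List.mem_map.mpr ⟨_, hd, rfl⟩
  obtain ⟨habT, hne⟩ := (fromEdgeSet_adj T).mp hab
  refine ⟨s(a, b), habT, fun habS => hb (ha.trans (Adj.reachable ?_)),
    swap hS fun h => hb (ha.trans h), swap hT fun h => ?_⟩
  · exact deleteEdges_adj.mpr ⟨(fromEdgeSet_adj S).mpr ⟨habS, hne⟩, fun h => heT (h ▸ habT)⟩
  · classical
    obtain ⟨q, hq⟩ := reachable_deleteEdges_iff_exists_walk.mp h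
    have hqp : q.toPath = ⟨p, hp⟩ := (hT.isAcyclic.subsingleton_path _ _).elim _ _
    exact hq (q.edges_toPath_subset_edges (by rw [hqp]; exact hpe))

open SimpleGraph in
/-- A spanning tree contained in another one is equal to it. -/
theorem SimpleGraph.IsTree.eq_of_subset {V : Type*} {S T : Set (Sym2 V)}
    (hS : (fromEdgeSet S).IsTree) (hT : (fromEdgeSet T).IsTree)
    (hdiag : ∀ e ∈ T, ¬ e.IsDiag) (hST : S ⊆ T) : S = T := by
  refine hST.antisymm fun e he => ?_
  have hle := (isTree_iff_minimal_connected.mp hT).2 hS.connected (fromEdgeSet_mono hST)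
  have h : e ∈ (fromEdgeSet T).edgeSet := by
    rw [edgeSet_fromEdgeSet]
    exact ⟨he, hdiag e he⟩
  have := edgeSet_mono hle h
  rw [edgeSet_fromEdgeSet] at this
  exact this.1

open SimpleGraph in
/-- In a minimum spanning tree, an edge weighs at most as much as any edge replacing it. -/
theorem IsMinSpanningTree.le_of_exchange {V : Type*} [Fintype V] [DecidableEq V]
    {G : SimpleGraph V} {w : Sym2 V → ℝ} {T : Finset (Sym2 V)} (hT : IsMinSpanningTree G w T)
    {e g : Sym2 V} (he : e ∈ T) (hgT : g ∉ T) (hgG : g ∈ G.edgeSet)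
    (htree : (fromEdgeSet (insert g ((T : Set (Sym2 V)) \ {e}))).IsTree) : w e ≤ w g := by
  have hcoe : ((insert g (T.erase e) : Finset (Sym2 V)) : Set (Sym2 V)) =
      insert g ((T : Set (Sym2 V)) \ {e}) := by
    simp
  have h := hT.2.2.2 (insert g (T.erase e))
    (by rw [hcoe]; exact Set.insert_subset hgG (Set.sdiff_subset.trans hT.1))
    (by rw [hcoe]; exact htree.connected) (by rw [hcoe]; exact htree.isAcyclic)
  rw [Finset.sum_insert (fun h => hgT (Finset.mem_of_mem_erase h)),
    ← Finset.add_sum_erase _ _ he] at h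
  linarith

/-- Increasing the weight of a single edge `f` by `δ > 0` either leaves the
minimum spanning tree unchanged, or replaces `f` by a single edge `g` of weight
at most `w f + δ`. -/
theorem mst_local_update
    {V : Type*} [Fintype V] [DecidableEq V]
    (G : SimpleGraph V) (hG : G.Connected)
    (f : Sym2 V) (hf : f ∈ G.edgeSet) (δ : ℝ) (hδ : 0 < δ)
    (w : Sym2 V → ℝ) (hw0 : ∀ e, 0 ≤ w e)
    (hinj : Set.InjOn w G.edgeSet)
    (hinj' : Set.InjOn (fun e => w e + if e = f then δ else 0) G.edgeSet)
    (T Tδ : Finset (Sym2 V))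
    (hT : IsMinSpanningTree G w T)
    (hTδ : IsMinSpanningTree G (fun e => w e + if e = f then δ else 0) Tδ) :
    Tδ = T ∨ ∃ g ∈ G.edgeSet, w g ≤ w f + δ ∧ Tδ = insert g (T.erase f) := by
  have tT : (SimpleGraph.fromEdgeSet (T : Set (Sym2 V))).IsTree := ⟨hT.2.1, hT.2.2.1⟩
  have tTδ : (SimpleGraph.fromEdgeSet (Tδ : Set (Sym2 V))).IsTree := ⟨hTδ.2.1, hTδ.2.2.1⟩
  have hdiag : ∀ e ∈ G.edgeSet, ¬ e.IsDiag := fun e he => G.not_isDiag_of_mem_edgeSet he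
  have hdiff : ∀ e ∈ T, e ∉ Tδ → e = f := by
    intro e he heδ
    by_contra hef
    obtain ⟨g, hgδ, hgT, h1, h2⟩ :=
      tT.exists_symmetric_exchange tTδ he heδ (hdiag e (hT.1 he))
    have hle := hT.le_of_exchange he hgT (hTδ.1 hgδ) h1
    have hge := hTδ.le_of_exchange hgδ heδ (hT.1 he) h2
    simp only [if_neg hef, add_zero] at hge
    have hpos : (0 : ℝ) ≤ if g = f then δ else 0 := by split_ifs <;> linarith
    exact hgT (hinj (hT.1 he) (hTδ.1 hgδ) (by linarith) ▸ he)
  by_cases hfT : f ∈ T ∧ f ∉ Tδ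
  · obtain ⟨hfT, hfδ⟩ := hfT
    obtain ⟨g, hgδ, hgT, h1, h2⟩ :=
      tT.exists_symmetric_exchange tTδ hfT hfδ (hdiag f hf)
    have hge := hTδ.le_of_exchange hgδ hfδ hf h2
    have hgf : g ≠ f := fun h => hgT (h ▸ hfT)
    simp only [if_neg hgf, add_zero, if_true] at hge
    refine Or.inr ⟨g, hTδ.1 hgδ, hge, ?_⟩
    have heq := h1.eq_of_subset tTδ (fun e he => hdiag e (hTδ.1 he)) (by
      refine Set.insert_subset hgδ fun e he => ?_
      by_contra heδ
      exact he.2 (hdiff e he.1 heδ))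
    rw [← Finset.coe_inj, ← heq]
    simp
  · refine Or.inl (Finset.coe_injective ?_).symm
    refine tT.eq_of_subset tTδ (fun e he => hdiag e (hTδ.1 he)) fun e he => ?_
    by_contra heδ
    have hef := hdiff e he heδ
    exact hfT ⟨hef ▸ he, hef ▸ heδ⟩
end

section
/- Let E be a finite type, let k be a positive natural number, let 𝓕 be a nonempty family of finite subsets of E each of cardinality k, let ε > 0, let w : E → ℝ be nonnegative, and let opt := min_{T'∈𝓕} Σ_{e∈T'} w(e). Let ŵ : E → ℝ satisfy w(e) ≤ ŵ(e) ≤ w(e) + ε·opt/k for all e ∈ E. If T ∈ 𝓕 minimizes Σ_{e∈T} ŵ(e) over 𝓕, then Σ_{e∈T} w(e) ≤ (1+ε)·opt. -/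
/-- If all members of `𝓕` have cardinality `k`, each weight `w e` is perturbed
to a value `wHat e ∈ [w e, w e + ε·opt/k]`, and `T` minimizes the perturbed
weight over `𝓕`, then `T` is a `(1+ε)`-approximate minimum-weight member of
`𝓕` with respect to `w`. -/
theorem additive_perturbation_approximation
    {E : Type*} [Fintype E]
    (k : ℕ) (hk : 0 < k)
    (𝓕 : Set (Finset E)) (h𝓕 : 𝓕.Nonempty)
    (hcard : ∀ T ∈ 𝓕, T.card = k)
    (ε : ℝ) (hε : 0 < ε)
    (w : E → ℝ) (hw : ∀ e, 0 ≤ w e)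
    (opt : ℝ)
    (hopt : IsLeast {s : ℝ | ∃ T' ∈ 𝓕, s = ∑ e ∈ T', w e} opt)
    (wHat : E → ℝ)
    (hwHat : ∀ e, w e ≤ wHat e ∧ wHat e ≤ w e + ε * opt / k)
    (T : Finset E) (hT : T ∈ 𝓕)
    (hTmin : ∀ T' ∈ 𝓕, ∑ e ∈ T, wHat e ≤ ∑ e ∈ T', wHat e) :
    ∑ e ∈ T, w e ≤ (1 + ε) * opt := by
  obtain ⟨T', hT', rfl⟩ := hopt.1
  have hk0 : (k : ℝ) ≠ 0 := by positivity
  calc ∑ e ∈ T, w e ≤ ∑ e ∈ T, wHat e := Finset.sum_le_sum fun e _ => (hwHat e).1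
    _ ≤ ∑ e ∈ T', wHat e := hTmin T' hT'
    _ ≤ ∑ e ∈ T', (w e + ε * (∑ e ∈ T', w e) / k) :=
      Finset.sum_le_sum fun e _ => (hwHat e).2
    _ = (1 + ε) * ∑ e ∈ T', w e := by
      rw [Finset.sum_add_distrib, Finset.sum_const, hcard T' hT', nsmul_eq_mul,
        mul_div_cancel₀ _ hk0]
      ring
end

section
/- Let G be a simple graph on a finite vertex type, let s and t be vertices with G.Reachable s t, and write D for the (unweighted) shortest-path distance dist_G(s,t). Let γ > 0 and d, l be real numbers satisfying γ·D ≥ 1, l ≥ γ, d − l ≥ 0, and d + l ≤ 1, and assume every vertex of the graph is reachable from s (e.g. G is connected). Then the set V_{d,l} := { v : dist_G(s,v) ≤ (d+l)·D and dist_G(v,t) ≤ (1−d+l)·D } has cardinality at least γ·D, i.e. (card V_{d,l} : ℝ) ≥ γ·D. -/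
/-- The set of candidate pivots `V_{d,l}` contains at least `γ · dist(s,t)`
vertices. -/
theorem pivot_set_size_lower_bound
    {V : Type*} [Fintype V] (G : SimpleGraph V) (s t : V)
    (hst : G.Reachable s t)
    (γ d l : ℝ) (hγ : 0 < γ)
    (hγD : 1 ≤ γ * (G.dist s t : ℝ))
    (hl : γ ≤ l) (hdl : 0 ≤ d - l) (hdl' : d + l ≤ 1)
    (hreach : ∀ v : V, G.Reachable s v) :
    γ * (G.dist s t : ℝ) ≤
      (({v : V | (G.dist s v : ℝ) ≤ (d + l) * (G.dist s t : ℝ) ∧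
          (G.dist v t : ℝ) ≤ (1 - d + l) * (G.dist s t : ℝ)}.ncard : ℝ)) := by
  obtain ⟨p, hp⟩ := hst.exists_walk_length_eq_dist
  have hpath := p.isPath_of_length_eq_dist hp
  rw [← hp] at hγD ⊢
  have hD : (0 : ℝ) ≤ p.length := Nat.cast_nonneg _
  have hb : 0 ≤ (d + l) * (p.length : ℝ) := mul_nonneg (by linarith) hD
  have hlD : γ * (p.length : ℝ) ≤ l * p.length := mul_le_mul_of_nonneg_right hl hD
  set I := Finset.Icc ⌈(d - l) * (p.length : ℝ)⌉₊ ⌊(d + l) * (p.length : ℝ)⌋₊ with hI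
  have hle : ∀ i ∈ I, i ≤ p.length := by
    intro i hi
    have h := (Nat.le_floor_iff hb).1 (Finset.mem_Icc.1 hi).2
    have h' : (i : ℝ) ≤ p.length := h.trans (mul_le_of_le_one_left hD hdl')
    exact_mod_cast h'
  have hcard : γ * (p.length : ℝ) ≤ (I.card : ℝ) := by
    have h₁ := Nat.ceil_lt_add_one (mul_nonneg hdl hD)
    have h₂ := Nat.lt_floor_add_one ((d + l) * (p.length : ℝ))
    have h₃ : (⌊(d + l) * (p.length : ℝ)⌋₊ : ℝ) + 1 - ⌈(d - l) * (p.length : ℝ)⌉₊ ≤ I.card := by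
      rw [hI, Nat.card_Icc, sub_le_iff_le_add]
      exact_mod_cast Nat.sub_le_iff_le_add.1 le_rfl
    linarith
  refine hcard.trans (Nat.cast_le.2 ?_)
  rw [← Set.ncard_coe_finset]
  refine Set.ncard_le_ncard_of_injOn p.getVert ?_
    (hpath.getVert_injOn.mono hle) (Set.toFinite _)
  intro i hi
  have hi' : i ≤ p.length := hle i hi
  obtain ⟨ha, hb'⟩ := Finset.mem_Icc.1 (Finset.mem_coe.1 hi)
  have ha := Nat.ceil_le.1 ha
  have hb' := (Nat.le_floor_iff hb).1 hb'
  have hs : (G.dist s (p.getVert i) : ℝ) ≤ i := by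
    have h := SimpleGraph.dist_le (p.take i)
    rw [SimpleGraph.Walk.take_length] at h
    exact_mod_cast h.trans (min_le_left _ _)
  have ht : (G.dist (p.getVert i) t : ℝ) ≤ p.length - i := by
    have h := SimpleGraph.dist_le (p.drop i)
    rw [SimpleGraph.Walk.drop_length] at h
    rw [← Nat.cast_sub hi']
    exact_mod_cast h
  exact ⟨hs.trans hb', by linarith⟩
end

section
/- Let G be a connected simple graph on a finite vertex type, let s, t, p be vertices, let {u,v} be an edge of G (i.e. G.Adj u v), and let γ ≥ 0. For vertices x, y define opt(x, y, e) := min( dist_G(x,u) + 1 + dist_G(v,y), dist_G(x,v) + 1 + dist_G(u,y) ), the length of a shortest x–y walk passing through the edge e = {u,v}. Suppose that: (1) opt(s, p, e) ≤ (1 + 16γ)·dist_G(s,p); (2) dist_G(s,p) + dist_G(p,t) ≤ (1 + 4γ)·dist_G(s,t); and (3) dist_G(s,p) ≤ (3/4)·dist_G(s,t). Then opt(s, t, e) ≤ (1 + 16γ)·dist_G(s,t). -/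
/-- If the recursive call for the pair `(s,p)` is active with respect to the
edge `{u,v}` (hypothesis `h1`), and `p` was chosen as a valid pivot for `(s,t)`
(hypotheses `h2` and `h3`), then the call for `(s,t)` is also active. -/
theorem active_subcall_implies_active_call
    {V : Type*} [Fintype V] (G : SimpleGraph V) (hG : G.Connected)
    (s t p u v : V) (huv : G.Adj u v) (γ : ℝ) (hγ : 0 ≤ γ)
    (h1 : min ((G.dist s u : ℝ) + 1 + (G.dist v p : ℝ))
            ((G.dist s v : ℝ) + 1 + (G.dist u p : ℝ))
          ≤ (1 + 16 * γ) * (G.dist s p : ℝ))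
    (h2 : (G.dist s p : ℝ) + (G.dist p t : ℝ) ≤ (1 + 4 * γ) * (G.dist s t : ℝ))
    (h3 : (G.dist s p : ℝ) ≤ (3 / 4) * (G.dist s t : ℝ)) :
    min ((G.dist s u : ℝ) + 1 + (G.dist v t : ℝ))
        ((G.dist s v : ℝ) + 1 + (G.dist u t : ℝ))
      ≤ (1 + 16 * γ) * (G.dist s t : ℝ) := by
  have hv : (G.dist v t : ℝ) ≤ G.dist v p + G.dist p t := by
    exact_mod_cast hG.dist_triangle
  have hu : (G.dist u t : ℝ) ≤ G.dist u p + G.dist p t := by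
    exact_mod_cast hG.dist_triangle
  have hsp : γ * (G.dist s p : ℝ) ≤ γ * ((3 / 4) * (G.dist s t : ℝ)) :=
    mul_le_mul_of_nonneg_left h3 hγ
  rcases min_le_iff.mp h1 with h | h
  · exact (min_le_left _ _).trans (by linarith)
  · exact (min_le_right _ _).trans (by linarith)
end

section
/- Let b > 0, let δ satisfy 0 < δ ≤ b, let w ≥ 0 be real, and let x satisfy 0 < x < 1. Define l := ⌊w/b⌋ and ŵ := l + 2 if x ≤ (l+1) − w/b, and ŵ := l + 3 otherwise. Define l' := ⌊(w+δ)/b⌋, define x' := x − δ/b if x > δ/b and x' := x − δ/b + 1 if x ≤ δ/b, and define ŵ' := l' + 2 if x' ≤ (l'+1) − (w+δ)/b, and ŵ' := l' + 3 otherwise. Then: if x > δ/b, then ŵ' = ŵ; and if x ≤ δ/b, then ŵ' = ŵ + 1. -/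
/-- Rounding `u` with a seed `x ∈ (0, 1]` amounts to taking the ceiling of `x + u`. -/
theorem rounding_eq_ceil (u x : ℝ) (hx0 : 0 < x) (hx1 : x ≤ 1) :
    (if x ≤ ((⌊u⌋ : ℝ) + 1) - u then ⌊u⌋ + 2 else ⌊u⌋ + 3) = ⌈x + u⌉ + 1 := by
  have h1 := Int.floor_le u
  have h2 := Int.lt_floor_add_one u
  split_ifs with h
  · have : ⌈x + u⌉ = ⌊u⌋ + 1 := by
      rw [Int.ceil_eq_iff]
      push_cast
      constructor <;> linarith
    omega
  · have : ⌈x + u⌉ = ⌊u⌋ + 2 := by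
      rw [Int.ceil_eq_iff]
      push_cast
      constructor <;> linarith
    omega

/-- Coupling lemma for the randomized rounding of edge weights in LipSP:
shifting the uniform seed `x` by `δ/b` (mod 1) couples the rounded weight for
`w` with the rounded weight for `w + δ`, so that the rounded weights coincide
when `x > δ/b` and differ by exactly `1` when `x ≤ δ/b`. -/
theorem rounding_coupling
    (b δ w x : ℝ) (hb : 0 < b) (hδ0 : 0 < δ) (hδb : δ ≤ b) (hw : 0 ≤ w)
    (hx0 : 0 < x) (hx1 : x < 1)
    (l l' : ℤ) (hl : l = ⌊w / b⌋) (hl' : l' = ⌊(w + δ) / b⌋)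
    (wHat : ℤ) (hwHat : wHat = if x ≤ ((l : ℝ) + 1) - w / b then l + 2 else l + 3)
    (x' : ℝ) (hx' : x' = if δ / b < x then x - δ / b else x - δ / b + 1)
    (wHat' : ℤ)
    (hwHat' : wHat' = if x' ≤ ((l' : ℝ) + 1) - (w + δ) / b then l' + 2 else l' + 3) :
    (δ / b < x → wHat' = wHat) ∧ (x ≤ δ / b → wHat' = wHat + 1) := by
  subst hl hl'
  have hd0 : 0 < δ / b := div_pos hδ0 hb
  have hd1 : δ / b ≤ 1 := (div_le_one hb).mpr hδb
  rw [rounding_eq_ceil _ _ hx0 hx1.le] at hwHat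
  have hx'_mem : 0 < x' ∧ x' ≤ 1 := by
    rw [hx']
    split_ifs <;> constructor <;> linarith
  rw [rounding_eq_ceil _ _ hx'_mem.1 hx'_mem.2, add_div] at hwHat'
  rw [hwHat, hwHat']
  constructor
  · intro h
    rw [hx', if_pos h, show x - δ / b + (w / b + δ / b) = x + w / b by ring]
  · intro h
    rw [hx', if_neg h.not_gt,
      show x - δ / b + 1 + (w / b + δ / b) = x + w / b + 1 by ring, Int.ceil_add_one]
end

section
/- Fix ε with 0 < ε ≤ 1/10. Let p, p' ∈ [0,1] satisfy p ≥ 1/2 and p' + (1 − p')·(1 − 10ε) ≤ (1 + ε)·(1 − 10ε). Let π : Fin 2 → Fin 2 → ℝ be nonnegative with row marginals Σ_j π(0,j) = p, Σ_j π(1,j) = 1 − p and column marginals Σ_i π(i,0) = p', Σ_i π(i,1) = 1 − p'. Define costs c(0,0) = 0, c(1,1) = 10ε, c(0,1) = 2 − 10ε, c(1,0) = 2. Then Σ_{i,j} π(i,j)·c(i,j) ≥ 1/2. -/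
/-- Core of the Ω(ε⁻¹) Lipschitz lower bound for (1+ε)-approximate minimum
spanning tree: any coupling `π` of the output distributions on the two weight
vectors has expected weighted-mapping cost at least 1/2. -/
theorem mst_lipschitz_lower_bound_core
    (ε : ℝ) (hε0 : 0 < ε) (hε1 : ε ≤ 1 / 10)
    (p p' : ℝ)
    (hp0 : 0 ≤ p) (hp1 : p ≤ 1) (hp'0 : 0 ≤ p') (hp'1 : p' ≤ 1)
    (hphalf : 1 / 2 ≤ p)
    (happrox : p' + (1 - p') * (1 - 10 * ε) ≤ (1 + ε) * (1 - 10 * ε))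
    (π : Fin 2 → Fin 2 → ℝ) (hπ : ∀ i j, 0 ≤ π i j)
    (hrow0 : ∑ j, π 0 j = p) (hrow1 : ∑ j, π 1 j = 1 - p)
    (hcol0 : ∑ i, π i 0 = p') (hcol1 : ∑ i, π i 1 = 1 - p')
    (c : Fin 2 → Fin 2 → ℝ)
    (hc00 : c 0 0 = 0) (hc11 : c 1 1 = 10 * ε)
    (hc01 : c 0 1 = 2 - 10 * ε) (hc10 : c 1 0 = 2) :
    1 / 2 ≤ ∑ i, ∑ j, π i j * c i j := by
  simp only [Fin.sum_univ_two] at *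
  have hp'_le : p' ≤ 1 / 10 - ε := by
    have h : ε * (10 * p') ≤ ε * (1 - 10 * ε) := by linarith
    linarith [le_of_mul_le_mul_left h hε0]
  have h01 : 2 / 5 + ε ≤ π 0 1 := by linarith [hπ 1 0]
  have hcost : (2 / 5 + ε) * (2 - 10 * ε) ≤ π 0 1 * (2 - 10 * ε) :=
    mul_le_mul_of_nonneg_right h01 (by linarith)
  have hbound : 1 / 2 ≤ (2 / 5 + ε) * (2 - 10 * ε) := by nlinarith
  have h11 : 0 ≤ π 1 1 * (10 * ε) := mul_nonneg (hπ 1 1) (by linarith)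
  rw [hc00, hc11, hc01, hc10]
  linarith [hπ 1 0]
end

section
/- Let U and V be finite nonempty types with card V ≥ 3, let w : U → V → ℝ be nonnegative, let ε > 0 and B > 0. Let P be the set of x : U → V → ℝ with x ≥ 0, Σ_j x(i,j) ≤ 1 for every i ∈ U, and Σ_i x(i,j) ≤ 1 for every j ∈ V. Let x* ∈ P maximize the linear objective Σ_{i,j} w(i,j)·y(i,j) over y ∈ P, and write opt := Σ_{i,j} w(i,j)·x*(i,j). Suppose B ≤ 2ε·opt/((card U)·log(card V)), and let x ∈ P maximize the entropy-regularized objective Σ_{i,j} w(i,j)·y(i,j) − B·Σ_{i,j} y(i,j)·log y(i,j) over y ∈ P. Then Σ_{i,j} w(i,j)·x(i,j) ≥ (1 − 2ε)·opt. -/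
/-- The tangent line bound for `-a log a` at `a = 1 / n`. -/
lemma neg_mul_log_le_tangent {a n : ℝ} (ha : 0 ≤ a) (hn : 0 < n) :
    -(a * Real.log a) ≤ 1 / n - a + a * Real.log n := by
  rcases ha.eq_or_lt with rfl | ha
  · simp [hn.le]
  · have h := mul_le_mul_of_nonneg_left
      (Real.log_le_sub_one_of_pos (show 0 < 1 / (n * a) by positivity)) ha.le
    rw [one_div, Real.log_inv, Real.log_mul hn.ne' ha.ne'] at h
    have h' : a * ((n * a)⁻¹ - 1) = 1 / n - a := by field_simp
    linarith

/-- The entropy of a subprobability vector on at least three points is at most the logarithm of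
the number of points. -/
lemma neg_sum_mul_log_le_log_card {V : Type*} [Fintype V] (hV : 3 ≤ Fintype.card V)
    {p : V → ℝ} (hp : ∀ j, 0 ≤ p j) (hsum : ∑ j, p j ≤ 1) :
    -∑ j, p j * Real.log (p j) ≤ Real.log (Fintype.card V) := by
  have hV' : (3 : ℝ) ≤ Fintype.card V := by exact_mod_cast hV
  have hn : (0 : ℝ) < Fintype.card V := by linarith
  have hlog : 1 ≤ Real.log (Fintype.card V) := by
    rw [Real.le_log_iff_exp_le hn]
    linarith [Real.exp_one_lt_d9]
  have h := Finset.sum_le_sum fun j (_ : j ∈ Finset.univ) => neg_mul_log_le_tangent (hp j) hn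
  rw [Finset.sum_neg_distrib, Finset.sum_add_distrib, Finset.sum_sub_distrib,
    ← Finset.sum_mul, Finset.sum_const, Finset.card_univ, nsmul_eq_mul,
    mul_one_div_cancel hn.ne'] at h
  nlinarith

/-- The optimal solution of the entropy-regularized LP for maximum weight
bipartite matching is a `(1 - 2ε)`-approximate solution to the original LP,
provided the regularization strength `B` is at most
`2ε·opt/(card U · log (card V))`. -/
theorem entropy_regularized_lp_near_optimal
    {U V : Type*} [Fintype U] [Fintype V] [Nonempty U] [Nonempty V]
    (hV : 3 ≤ Fintype.card V)
    (w : U → V → ℝ) (hw : ∀ i j, 0 ≤ w i j)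
    (ε B : ℝ) (hε : 0 < ε) (hB : 0 < B)
    (P : Set (U → V → ℝ))
    (hP : P = {x | (∀ i j, 0 ≤ x i j) ∧ (∀ i, ∑ j, x i j ≤ 1) ∧
      (∀ j, ∑ i, x i j ≤ 1)})
    (xstar : U → V → ℝ) (hxstar : xstar ∈ P)
    (hxstarmax : ∀ y ∈ P, ∑ i, ∑ j, w i j * y i j ≤ ∑ i, ∑ j, w i j * xstar i j)
    (opt : ℝ) (hopt : opt = ∑ i, ∑ j, w i j * xstar i j)
    (hBbound : B ≤ 2 * ε * opt / ((Fintype.card U : ℝ) * Real.log (Fintype.card V)))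
    (x : U → V → ℝ) (hx : x ∈ P)
    (hxmax : ∀ y ∈ P,
      (∑ i, ∑ j, w i j * y i j) - B * ∑ i, ∑ j, y i j * Real.log (y i j) ≤
      (∑ i, ∑ j, w i j * x i j) - B * ∑ i, ∑ j, x i j * Real.log (x i j)) :
    (1 - 2 * ε) * opt ≤ ∑ i, ∑ j, w i j * x i j := by
  subst hP
  obtain ⟨hx0, hxrow, -⟩ := hx
  have hV' : (3 : ℝ) ≤ Fintype.card V := by exact_mod_cast hV
  have hlog : 0 < Real.log (Fintype.card V) := Real.log_pos (by linarith)
  have hU : (0 : ℝ) < Fintype.card U := by exact_mod_cast Fintype.card_pos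
  have hent : -∑ i, ∑ j, x i j * Real.log (x i j) ≤
      (Fintype.card U : ℝ) * Real.log (Fintype.card V) := by
    rw [← Finset.sum_neg_distrib]
    refine (Finset.sum_le_sum fun i _ =>
      neg_sum_mul_log_le_log_card hV (hx0 i) (hxrow i)).trans_eq ?_
    simp
  have hentstar : ∑ i, ∑ j, xstar i j * Real.log (xstar i j) ≤ 0 := by
    obtain ⟨h0, hrow, -⟩ := hxstar
    refine Finset.sum_nonpos fun i _ => Finset.sum_nonpos fun j _ =>
      Real.mul_log_nonpos (h0 i j) ?_
    exact (Finset.single_le_sum (fun k _ => h0 i k) (Finset.mem_univ j)).trans (hrow i)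
  have hmax := hxmax xstar hxstar
  rw [← hopt] at hmax
  rw [le_div_iff₀ (mul_pos hU hlog)] at hBbound
  have h₁ := mul_le_mul_of_nonneg_left hent hB.le
  have h₂ := mul_nonpos_of_nonneg_of_nonpos hB.le hentstar
  linarith
end

section
/- Let U and V be finite types, let w : U → V → ℝ, let B > 0, and define f(x) := Σ_{i,j} w(i,j)·x(i,j) − B·Σ_{i,j} x(i,j)·log x(i,j) for x : U → V → ℝ. Let x and y have strictly positive entries and satisfy Σ_{j∈V} x(i,j) ≤ 1 and Σ_{j∈V} y(i,j) ≤ 1 for every i ∈ U. Then f(x) − f(y) ≥ Σ_{i,j} (w(i,j) − B·(log x(i,j) + 1))·(x(i,j) − y(i,j)) + (B/2)·Σ_{i∈U} ( Σ_{j∈V} |x(i,j) − y(i,j)| )². -/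
/-- A rational lower bound for `log t` that agrees with it to third order at `t = 1`. -/
theorem div_le_log_of_pos {t : ℝ} (ht : 0 < t) :
    (5 * t ^ 2 - 4 * t - 1) / (2 * t ^ 2 + 4 * t) ≤ Real.log t := by
  let h : ℝ → ℝ := fun s => Real.log s - (5 * s ^ 2 - 4 * s - 1) / (2 * s ^ 2 + 4 * s)
  have hderiv (s : ℝ) (hs : 0 < s) :
      HasDerivAt h ((s - 1) ^ 3 / (s ^ 2 * (s + 2) ^ 2)) s := by
    have hden : 2 * s ^ 2 + 4 * s ≠ 0 := by positivity
    have hnum' : HasDerivAt (fun s : ℝ => 5 * s ^ 2 - 4 * s - 1) (10 * s - 4) s := by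
      have := (((hasDerivAt_pow 2 s).const_mul 5).sub ((hasDerivAt_id s).const_mul 4)).sub_const 1
      exact this.congr_deriv (by norm_num; ring)
    have hden' : HasDerivAt (fun s : ℝ => 2 * s ^ 2 + 4 * s) (4 * s + 4) s := by
      have := ((hasDerivAt_pow 2 s).const_mul 2).add ((hasDerivAt_id s).const_mul 4)
      exact this.congr_deriv (by norm_num; ring)
    refine ((Real.hasDerivAt_log hs.ne').sub (hnum'.div hden' hden)).congr_deriv ?_
    have : s + 2 ≠ 0 := by positivity
    rw [show 2 * s ^ 2 + 4 * s = 2 * s * (s + 2) by ring]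
    field_simp
    ring
  have h1 : h 1 = 0 := by norm_num [h]
  suffices h 1 ≤ h t by rw [h1] at this; exact sub_nonneg.mp this
  rcases le_total t 1 with h_le | h_le
  · have hanti : AntitoneOn h (Set.Icc t 1) := by
      refine antitoneOn_of_hasDerivWithinAt_nonpos (convex_Icc t 1)
        (fun s hs => (hderiv s (ht.trans_le hs.1)).continuousAt.continuousWithinAt)
        (fun s hs => (hderiv s (ht.trans_le (interior_subset hs).1)).hasDerivWithinAt)
        (fun s hs => ?_)
      have hs1 : s - 1 ≤ 0 := sub_nonpos.mpr (interior_subset hs).2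
      exact div_nonpos_of_nonpos_of_nonneg (Odd.pow_nonpos (by decide) hs1) (by positivity)
    exact hanti (Set.left_mem_Icc.mpr h_le) (Set.right_mem_Icc.mpr h_le) h_le
  · have hmono : MonotoneOn h (Set.Icc 1 t) := by
      refine monotoneOn_of_hasDerivWithinAt_nonneg (convex_Icc 1 t)
        (fun s hs => (hderiv s (one_pos.trans_le hs.1)).continuousAt.continuousWithinAt)
        (fun s hs => (hderiv s (one_pos.trans_le (interior_subset hs).1)).hasDerivWithinAt)
        (fun s hs => ?_)
      have hs1 : 0 ≤ s - 1 := sub_nonneg.mpr (interior_subset hs).1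
      positivity
    exact hmono (Set.left_mem_Icc.mpr h_le) (Set.right_mem_Icc.mpr h_le) h_le

/-- Pointwise form of Pinsker's inequality. -/
theorem sq_sub_le_mul_klTerm {a b : ℝ} (ha : 0 < a) (hb : 0 < b) :
    (a - b) ^ 2 ≤ (4 / 3 * a + 2 / 3 * b) * (b * (Real.log b - Real.log a) + a - b) := by
  have hlog := div_le_log_of_pos (div_pos hb ha)
  rw [Real.log_div hb.ne' ha.ne'] at hlog
  calc (a - b) ^ 2
      = (4 / 3 * a + 2 / 3 * b) * (b * ((5 * (b / a) ^ 2 - 4 * (b / a) - 1) /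
          (2 * (b / a) ^ 2 + 4 * (b / a))) + a - b) := by
        rw [show (5 * (b / a) ^ 2 - 4 * (b / a) - 1) / (2 * (b / a) ^ 2 + 4 * (b / a))
          = (5 * b ^ 2 - 4 * a * b - a ^ 2) / (2 * b * (b + 2 * a)) by field_simp; ring]
        field_simp
        ring
    _ ≤ _ := by gcongr

/-- Pinsker's inequality for positive vectors of total mass at most one. -/
theorem sq_sum_abs_sub_le_two_mul_sum_klTerm {ι : Type*} [Fintype ι] {a b : ι → ℝ}
    (ha : ∀ j, 0 < a j) (hb : ∀ j, 0 < b j) (ha1 : ∑ j, a j ≤ 1) (hb1 : ∑ j, b j ≤ 1) :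
    (∑ j, |a j - b j|) ^ 2 ≤ 2 * ∑ j, (b j * (Real.log (b j) - Real.log (a j)) + a j - b j) := by
  have hpt (j : ι) := sq_sub_le_mul_klTerm (ha j) (hb j)
  have hweight (j : ι) : 0 < 4 / 3 * a j + 2 / 3 * b j := by
    have := ha j
    have := hb j
    positivity
  have hkl (j : ι) : 0 ≤ b j * (Real.log (b j) - Real.log (a j)) + a j - b j :=
    nonneg_of_mul_nonneg_right ((sq_nonneg _).trans (hpt j)) (hweight j)
  calc (∑ j, |a j - b j|) ^ 2
      ≤ (∑ j, (4 / 3 * a j + 2 / 3 * b j)) *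
          ∑ j, (b j * (Real.log (b j) - Real.log (a j)) + a j - b j) :=
        Finset.sum_sq_le_sum_mul_sum_of_sq_le_mul _ (fun j _ => (hweight j).le)
          (fun j _ => hkl j) (fun j _ => by rw [sq_abs]; exact hpt j)
    _ ≤ _ := by
        refine mul_le_mul_of_nonneg_right ?_ (Finset.sum_nonneg fun j _ => hkl j)
        rw [Finset.sum_add_distrib, ← Finset.mul_sum, ← Finset.mul_sum]
        linarith


/-- Strong-concavity-type inequality for the entropy-regularized LP objective:
`f` exceeds its first-order expansion at `x` by at least `(B/2)` times the sum
over rows of the squared ℓ₁ row-distance between `x` and `y`. -/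
theorem entropy_regularized_objective_strong_concavity
    {U V : Type*} [Fintype U] [Fintype V]
    (w : U → V → ℝ) (B : ℝ) (hB : 0 < B)
    (x y : U → V → ℝ)
    (hx : ∀ i j, 0 < x i j) (hy : ∀ i j, 0 < y i j)
    (hxrow : ∀ i, ∑ j, x i j ≤ 1) (hyrow : ∀ i, ∑ j, y i j ≤ 1) :
    (∑ i, ∑ j, (w i j - B * (Real.log (x i j) + 1)) * (x i j - y i j))
      + (B / 2) * ∑ i, (∑ j, |x i j - y i j|) ^ 2
    ≤ ((∑ i, ∑ j, w i j * x i j) - B * ∑ i, ∑ j, x i j * Real.log (x i j))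
      - ((∑ i, ∑ j, w i j * y i j) - B * ∑ i, ∑ j, y i j * Real.log (y i j)) := by
  have hrow := Finset.sum_le_sum fun i (_ : i ∈ Finset.univ) =>
    sq_sum_abs_sub_le_two_mul_sum_klTerm (hx i) (hy i) (hxrow i) (hyrow i)
  have hgap : ((∑ i, ∑ j, w i j * x i j) - B * ∑ i, ∑ j, x i j * Real.log (x i j))
      - ((∑ i, ∑ j, w i j * y i j) - B * ∑ i, ∑ j, y i j * Real.log (y i j))
      - ∑ i, ∑ j, (w i j - B * (Real.log (x i j) + 1)) * (x i j - y i j)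
      = B * ∑ i, ∑ j, (y i j * (Real.log (y i j) - Real.log (x i j)) + x i j - y i j) := by
    simp only [Finset.mul_sum, ← Finset.sum_sub_distrib]
    refine Finset.sum_congr rfl fun i _ => Finset.sum_congr rfl fun j _ => ?_
    ring
  rw [← Finset.mul_sum] at hrow
  have := mul_le_mul_of_nonneg_left hrow (half_pos hB).le
  linarith
end

section
/- Let U and V be finite nonempty types, let w : U → V → ℝ be nonnegative, let B > 0, let δ > 0, and let f₀ ∈ U × V. Let P be the set of x : U → V → ℝ with x ≥ 0, Σ_j x(i,j) ≤ 1 for every i ∈ U, and Σ_i x(i,j) ≤ 1 for every j ∈ V. Define g(x) := Σ_{i,j} w(i,j)·x(i,j) − B·Σ_{i,j} x(i,j)·log x(i,j) and g'(x) := g(x) + δ·x(f₀). Suppose x ∈ P maximizes g over P, x' ∈ P maximizes g' over P, and all entries of x and x' are strictly positive. Then Σ_{i,j} |x(i,j) − x'(i,j)| ≤ √(card U)·δ/B. -/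
/-- The logarithmic mean of two positive reals is at most their arithmetic mean. -/
lemma sq_sub_le_mul_log_sub_log {a b : ℝ} (ha : 0 < a) (hb : 0 < b) :
    (a - b) ^ 2 ≤ (a - b) * (Real.log a - Real.log b) * ((a + b) / 2) := by
  wlog hab : b ≤ a generalizing a b
  · have h := this hb ha (le_of_not_ge hab)
    linarith
  have h := Real.le_log_one_add_of_nonneg (x := (a - b) / b) (div_nonneg (by linarith) hb.le)
  have h1 : 1 + (a - b) / b = a / b := by field_simp; ring
  have h2 : 2 * ((a - b) / b) / ((a - b) / b + 2) = 2 * (a - b) / (a + b) := by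
    have : (a - b) / b + 2 = (a + b) / b := by field_simp; ring
    rw [this]
    field_simp
  rw [h1, h2, Real.log_div ha.ne' hb.ne', div_le_iff₀ (by linarith)] at h
  nlinarith [mul_le_mul_of_nonneg_left h (sub_nonneg.2 hab)]

/-- If two positive vectors have mass at most one, their squared `ℓ₁` distance is at most
their symmetrized relative entropy. -/
lemma sq_sum_abs_sub_le_sum_mul_log_sub_log {ι : Type*} [Fintype ι] {a b : ι → ℝ}
    (ha : ∀ i, 0 < a i) (hb : ∀ i, 0 < b i) (ha1 : ∑ i, a i ≤ 1) (hb1 : ∑ i, b i ≤ 1) :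
    (∑ i, |a i - b i|) ^ 2 ≤ ∑ i, (a i - b i) * (Real.log (a i) - Real.log (b i)) := by
  have hpos : ∀ i, 0 ≤ (a i - b i) * (Real.log (a i) - Real.log (b i)) := fun i => by
    have hm : 0 < (a i + b i) / 2 := by linarith [ha i, hb i]
    exact nonneg_of_mul_nonneg_left
      ((sq_nonneg _).trans (sq_sub_le_mul_log_sub_log (ha i) (hb i))) hm
  have hm1 : ∑ i, (a i + b i) / 2 ≤ 1 := by
    rw [← Finset.sum_div, Finset.sum_add_distrib]
    linarith
  calc (∑ i, |a i - b i|) ^ 2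
      ≤ (∑ i, (a i - b i) * (Real.log (a i) - Real.log (b i))) * ∑ i, (a i + b i) / 2 := by
        refine Finset.sum_sq_le_sum_mul_sum_of_sq_le_mul _ (fun i _ => hpos i)
          (fun i _ => by linarith [ha i, hb i]) fun i _ => ?_
        rw [sq_abs]
        exact sq_sub_le_mul_log_sub_log (ha i) (hb i)
    _ ≤ _ := mul_le_of_le_one_right (Finset.sum_nonneg fun i _ => hpos i) hm1

/-- A function maximized over `[0, 1]` at the left endpoint has nonpositive derivative there. -/
lemma HasDerivAt.nonpos_of_forall_le {F : ℝ → ℝ} {F' : ℝ} (hF : HasDerivAt F F' 0)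
    (h : ∀ t ∈ Set.Icc (0 : ℝ) 1, F t ≤ F 0) : F' ≤ 0 := by
  have hmax : IsLocalMaxOn F (Set.Icc 0 1) 0 := IsMaxOn.localize h
  have := hmax.hasFDerivWithinAt_nonpos hF.hasFDerivAt.hasFDerivWithinAt (y := 1)
    (mem_posTangentConeAt_of_segment_subset (by rw [zero_add, segment_eq_Icc zero_le_one]))
  simpa using this

/-- First-order optimality condition for an entropy-regularized linear objective. -/
lemma first_order_of_entropy_maximizer {U V : Type*} [Fintype U] [Fintype V]
    {w : U → V → ℝ} {B δ : ℝ} {p : U} {q : V} {P : Set (U → V → ℝ)} (hP : Convex ℝ P)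
    {x y : U → V → ℝ} (hx : x ∈ P) (hy : y ∈ P) (hxpos : ∀ i j, 0 < x i j)
    (hmax : ∀ z ∈ P,
      ((∑ i, ∑ j, w i j * z i j) - B * ∑ i, ∑ j, z i j * Real.log (z i j)) + δ * z p q ≤
      ((∑ i, ∑ j, w i j * x i j) - B * ∑ i, ∑ j, x i j * Real.log (x i j)) + δ * x p q) :
    (∑ i, ∑ j, w i j * (y i j - x i j))
      - B * (∑ i, ∑ j, (Real.log (x i j) + 1) * (y i j - x i j)) + δ * (y p q - x p q) ≤ 0 := by
  have hline : ∀ i j, HasDerivAt (fun t : ℝ => x i j + t * (y i j - x i j))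
      (y i j - x i j) 0 := fun i j => by
    simpa using ((hasDerivAt_id (0 : ℝ)).mul_const (y i j - x i j)).const_add (x i j)
  have hent : ∀ i j, HasDerivAt (fun t : ℝ => (x i j + t * (y i j - x i j)) *
      Real.log (x i j + t * (y i j - x i j)))
      ((Real.log (x i j) + 1) * (y i j - x i j)) 0 := fun i j => by
    refine HasDerivAt.comp (h₂ := fun s : ℝ => s * Real.log s) 0 ?_ (hline i j)
    simpa using Real.hasDerivAt_mul_log (hxpos i j).ne'
  refine HasDerivAt.nonpos_of_forall_le
    (((HasDerivAt.fun_sum fun i _ => HasDerivAt.fun_sum fun j _ =>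
      (hline i j).const_mul (w i j)).fun_sub
      ((HasDerivAt.fun_sum fun i _ => HasDerivAt.fun_sum fun j _ => hent i j).const_mul B)).fun_add
      ((hline p q).const_mul δ)) fun t ht => ?_
  simpa using hmax _ (hP.add_smul_sub_mem hx hy ht)

/-- The bipartite fractional matching polytope is convex. -/
lemma convex_fractional_matching (U V : Type*) [Fintype U] [Fintype V] :
    Convex ℝ {z : U → V → ℝ | (∀ i j, 0 ≤ z i j) ∧ (∀ i, ∑ j, z i j ≤ 1) ∧
      (∀ j, ∑ i, z i j ≤ 1)} := by
  rintro y ⟨hy, hyr, hyc⟩ z ⟨hz, hzr, hzc⟩ a b ha hb hab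
  refine ⟨fun i j => add_nonneg (mul_nonneg ha (hy i j)) (mul_nonneg hb (hz i j)),
    fun i => ?_, fun j => ?_⟩
  · simp only [Pi.add_apply, Pi.smul_apply, smul_eq_mul, Finset.sum_add_distrib, ← Finset.mul_sum]
    nlinarith [hyr i, hzr i]
  · simp only [Pi.add_apply, Pi.smul_apply, smul_eq_mul, Finset.sum_add_distrib, ← Finset.mul_sum]
    nlinarith [hyc j, hzc j]


/-- Stability of the entropy-regularized LP: increasing the weight of a single
coordinate `f₀` by `δ` moves the optimal solution by at most `√(card U)·δ/B`
in ℓ₁ distance. -/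
theorem entropy_regularized_lp_stability
    {U V : Type*} [Fintype U] [Fintype V] [Nonempty U] [Nonempty V]
    (w : U → V → ℝ) (hw : ∀ i j, 0 ≤ w i j)
    (B δ : ℝ) (hB : 0 < B) (hδ : 0 < δ)
    (f₀ : U × V)
    (P : Set (U → V → ℝ))
    (hP : P = {z | (∀ i j, 0 ≤ z i j) ∧ (∀ i, ∑ j, z i j ≤ 1) ∧
      (∀ j, ∑ i, z i j ≤ 1)})
    (x x' : U → V → ℝ) (hx : x ∈ P) (hx' : x' ∈ P)
    (hxpos : ∀ i j, 0 < x i j) (hx'pos : ∀ i j, 0 < x' i j)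
    (hxmax : ∀ y ∈ P,
      (∑ i, ∑ j, w i j * y i j) - B * ∑ i, ∑ j, y i j * Real.log (y i j) ≤
      (∑ i, ∑ j, w i j * x i j) - B * ∑ i, ∑ j, x i j * Real.log (x i j))
    (hx'max : ∀ y ∈ P,
      ((∑ i, ∑ j, w i j * y i j) - B * ∑ i, ∑ j, y i j * Real.log (y i j))
          + δ * y f₀.1 f₀.2 ≤
      ((∑ i, ∑ j, w i j * x' i j) - B * ∑ i, ∑ j, x' i j * Real.log (x' i j))
          + δ * x' f₀.1 f₀.2) :
    ∑ i, ∑ j, |x i j - x' i j| ≤ Real.sqrt (Fintype.card U) * δ / B := by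
  subst hP
  have hconv := convex_fractional_matching U V
  have h1 := first_order_of_entropy_maximizer (δ := 0) (p := f₀.1) (q := f₀.2) hconv hx hx' hxpos
    (by simpa using hxmax)
  have h2 := first_order_of_entropy_maximizer hconv hx' hx hx'pos hx'max
  set D : U → ℝ := fun i => ∑ j, |x i j - x' i j| with hD
  set S : U → ℝ := fun i => ∑ j, (x i j - x' i j) * (Real.log (x i j) - Real.log (x' i j)) with hS
  have hDS : ∀ i, D i ^ 2 ≤ S i := fun i =>
    sq_sum_abs_sub_le_sum_mul_log_sub_log (hxpos i) (hx'pos i) (hx.2.1 i) (hx'.2.1 i)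
  have hS0 : ∀ i, 0 ≤ S i := fun i => (sq_nonneg _).trans (hDS i)
  have hw_neg : ∑ i, ∑ j, w i j * (x i j - x' i j) = -∑ i, ∑ j, w i j * (x' i j - x i j) := by
    simp only [← Finset.sum_neg_distrib]
    exact Finset.sum_congr rfl fun i _ => Finset.sum_congr rfl fun j _ => by ring
  have hS_eq : ∑ i, S i = -(∑ i, ∑ j, (Real.log (x i j) + 1) * (x' i j - x i j))
      - ∑ i, ∑ j, (Real.log (x' i j) + 1) * (x i j - x' i j) := by
    simp only [hS, ← Finset.sum_neg_distrib, ← Finset.sum_sub_distrib]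
    exact Finset.sum_congr rfl fun i _ => Finset.sum_congr rfl fun j _ => by ring
  have hkey : B * ∑ i, S i ≤ δ * (x' f₀.1 f₀.2 - x f₀.1 f₀.2) := by
    rw [hS_eq]
    linarith
  set s := Real.sqrt (∑ i, S i) with hs
  have hs_sq : s ^ 2 = ∑ i, S i := Real.sq_sqrt (Finset.sum_nonneg fun i _ => hS0 i)
  have hs0 : 0 ≤ s := Real.sqrt_nonneg _
  have hentry : x' f₀.1 f₀.2 - x f₀.1 f₀.2 ≤ s := by
    calc x' f₀.1 f₀.2 - x f₀.1 f₀.2 ≤ |x f₀.1 f₀.2 - x' f₀.1 f₀.2| := by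
          rw [abs_sub_comm]
          exact le_abs_self _
      _ ≤ D f₀.1 := Finset.single_le_sum (f := fun j => |x f₀.1 j - x' f₀.1 j|)
          (fun j _ => abs_nonneg _) (Finset.mem_univ _)
      _ ≤ s := Real.le_sqrt_of_sq_le
          ((hDS _).trans (Finset.single_le_sum (fun i _ => hS0 i) (Finset.mem_univ _)))
  have hs_le : s ≤ δ / B := by
    rw [le_div_iff₀ hB]
    rcases hs0.eq_or_lt with h | h
    · rw [← h]
      linarith
    · refine le_of_mul_le_mul_right ?_ h
      calc s * B * s = B * ∑ i, S i := by rw [← hs_sq]; ring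
        _ ≤ δ * s := hkey.trans (mul_le_mul_of_nonneg_left hentry hδ.le)
  calc ∑ i, D i ≤ Real.sqrt (Fintype.card U * ∑ i, S i) := by
        refine Real.le_sqrt_of_sq_le (sq_sum_le_card_mul_sum_sq.trans ?_)
        exact mul_le_mul_of_nonneg_left (Finset.sum_le_sum fun i _ => hDS i) (Nat.cast_nonneg _)
    _ = Real.sqrt (Fintype.card U) * s := Real.sqrt_mul (Nat.cast_nonneg _) _
    _ ≤ Real.sqrt (Fintype.card U) * δ / B := by
        rw [mul_div_assoc]
        exact mul_le_mul_of_nonneg_left hs_le (Real.sqrt_nonneg _)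
end

section
/- For n ≥ 1 and y : Fin n → ℝ with 0 ≤ y(i) ≤ 1 for all i and Σ_i y(i) ≤ 1, define Y(y) := Σ_{S ⊆ Fin n} (1/(|S|+1)) · (Π_{i∈S} y(i)) · (Π_{i∉S} (1 − y(i))), where the sum is over all subsets S of Fin n. Then Y(y) ≥ 1/2 for every such n and y, and the value 1/2 is attained (e.g. by n = 1 and y(0) = 1); hence the infimum of Y(y) over all n ≥ 1 and all such y equals 1/2. -/
/-- `Ypb n y = E[1/(K+1)]` where `K` is the Poisson binomial random variable
with success probabilities `y 0, …, y (n-1)`. -/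
noncomputable def Ypb (n : ℕ) (y : Fin n → ℝ) : ℝ :=
  ∑ S : Finset (Fin n),
    (1 / ((S.card : ℝ) + 1)) * (∏ i ∈ S, y i) * (∏ i ∈ Sᶜ, (1 - y i))

theorem sum_prod_mul_prod_compl {ι : Type*} [Fintype ι] [DecidableEq ι] (f g : ι → ℝ) :
    ∑ S : Finset ι, (∏ i ∈ S, f i) * ∏ i ∈ Sᶜ, g i = ∏ i, (f i + g i) := by
  simp only [Finset.prod_add, Finset.powerset_univ, Finset.compl_eq_univ_sdiff]

/-- The mean of a Poisson binomial random variable is the sum of its success probabilities. -/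
theorem sum_card_mul_prod_mul_prod_compl {ι : Type*} [Fintype ι] [DecidableEq ι] (y : ι → ℝ) :
    ∑ S : Finset ι, (S.card : ℝ) * ((∏ i ∈ S, y i) * ∏ i ∈ Sᶜ, (1 - y i)) = ∑ i, y i := by
  have indicator (i : ι) (S : Finset ι) :
      (if i ∈ S then (∏ j ∈ S, y j) * ∏ j ∈ Sᶜ, (1 - y j) else 0) =
        (∏ j ∈ S, y j) * ∏ j ∈ Sᶜ, (if j = i then 0 else 1 - y j) := by
    split_ifs with hi
    · congr 1
      refine Finset.prod_congr rfl fun j hj => (if_neg ?_).symm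
      rintro rfl
      exact Finset.mem_compl.mp hj hi
    · rw [Finset.prod_eq_zero (Finset.mem_compl.mpr hi), mul_zero]
      exact if_pos rfl
  calc
    _ = ∑ S : Finset ι, ∑ i, if i ∈ S then (∏ j ∈ S, y j) * ∏ j ∈ Sᶜ, (1 - y j) else 0 := by
      simp
    _ = ∑ i, ∏ j, (y j + if j = i then 0 else 1 - y j) := by
      rw [Finset.sum_comm]
      simp only [indicator, sum_prod_mul_prod_compl]
    _ = ∑ i, y i := by
      refine Finset.sum_congr rfl fun i _ => ?_
      rw [Finset.prod_eq_single i (fun j _ hj => by simp [hj]) (by simp)]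
      simp

theorem one_sub_half_le_one_div_add_one (k : ℕ) : 1 - (k : ℝ) / 2 ≤ 1 / ((k : ℝ) + 1) := by
  rw [le_div_iff₀ (by positivity)]
  rcases k with _ | k
  · simp
  · push_cast
    nlinarith [sq_nonneg (k : ℝ), (Nat.cast_nonneg k : (0 : ℝ) ≤ k)]

theorem one_sub_half_sum_le_Ypb {n : ℕ} {y : Fin n → ℝ} (hy : ∀ i, 0 ≤ y i ∧ y i ≤ 1) :
    1 - (∑ i, y i) / 2 ≤ Ypb n y := by
  have total : ∑ S : Finset (Fin n), (∏ i ∈ S, y i) * ∏ i ∈ Sᶜ, (1 - y i) = 1 := by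
    simp [sum_prod_mul_prod_compl]
  calc
    _ = ∑ S : Finset (Fin n),
        (1 - (S.card : ℝ) / 2) * ((∏ i ∈ S, y i) * ∏ i ∈ Sᶜ, (1 - y i)) := by
      simp only [sub_mul, one_mul, Finset.sum_sub_distrib, total, div_mul_eq_mul_div,
        ← Finset.sum_div, sum_card_mul_prod_mul_prod_compl]
    _ ≤ Ypb n y := by
      refine Finset.sum_le_sum fun S _ => ?_
      rw [mul_assoc]
      exact mul_le_mul_of_nonneg_right (one_sub_half_le_one_div_add_one _)
        (mul_nonneg (Finset.prod_nonneg fun i _ => (hy i).1)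
          (Finset.prod_nonneg fun i _ => sub_nonneg.mpr (hy i).2))

theorem Ypb_one_one : Ypb 1 (fun _ => 1) = 1 / 2 := by
  rw [Ypb, Fintype.sum_eq_single Finset.univ]
  · rw [Finset.compl_univ]
    norm_num
  · intro S hS
    obtain ⟨i, hi⟩ := Finset.nonempty_iff_ne_empty.mpr
      (mt (Finset.compl_eq_empty_iff S).mp hS)
    rw [Finset.prod_eq_zero hi (sub_self 1), mul_zero]

/-- For every `n ≥ 1` and every `y : Fin n → [0,1]` with `Σ y i ≤ 1` one has
`Ypb n y ≥ 1/2`; the value `1/2` is attained, hence the infimum over all such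
`n` and `y` equals `1/2`. -/
theorem Ypb_inf_eq_half :
    (∀ n : ℕ, 1 ≤ n → ∀ y : Fin n → ℝ,
      (∀ i, 0 ≤ y i ∧ y i ≤ 1) → (∑ i, y i ≤ 1) → 1 / 2 ≤ Ypb n y) ∧
    (∃ n : ℕ, 1 ≤ n ∧ ∃ y : Fin n → ℝ,
      (∀ i, 0 ≤ y i ∧ y i ≤ 1) ∧ (∑ i, y i ≤ 1) ∧ Ypb n y = 1 / 2) ∧
    IsGLB {r : ℝ | ∃ n : ℕ, 1 ≤ n ∧ ∃ y : Fin n → ℝ,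
      (∀ i, 0 ≤ y i ∧ y i ≤ 1) ∧ (∑ i, y i ≤ 1) ∧ r = Ypb n y} (1 / 2) := by
  have lower : ∀ n : ℕ, 1 ≤ n → ∀ y : Fin n → ℝ,
      (∀ i, 0 ≤ y i ∧ y i ≤ 1) → (∑ i, y i ≤ 1) → 1 / 2 ≤ Ypb n y := by
    intro n _ y hy hsum
    linarith [one_sub_half_sum_le_Ypb hy]
  refine ⟨lower, ⟨1, le_rfl, fun _ => 1, by simp, by simp, Ypb_one_one⟩, ?_, ?_⟩
  · rintro r ⟨n, hn, y, hy, hsum, rfl⟩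
    exact lower n hn y hy hsum
  · intro b hb
    exact hb ⟨1, le_rfl, fun _ => 1, by simp, by simp, Ypb_one_one.symm⟩
end

section
/- Let n, m be natural numbers and let p, p' : Fin n → Option (Fin m). For each j ∈ Fin m let C(j) := {i ∈ Fin n : p(i) = some j} and C'(j) := {i ∈ Fin n : p'(i) = some j}, as finite sets. Then Σ_{i∈Fin n} Σ_{j∈Fin m} | (if p(i) = some j then 1/|C(j)| else 0) − (if p'(i) = some j then 1/|C'(j)| else 0) | ≤ 2 · |{ i ∈ Fin n : p(i) ≠ p'(i) }|. -/
/-- The `ℓ₁` distance between the uniform weights on two finite sets is at most the cardinality of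
their symmetric difference. -/
theorem sum_abs_uniform_sub_uniform_le {ι : Type*} [Fintype ι] [DecidableEq ι] (A B : Finset ι) :
    ∑ i, |(if i ∈ A then (1 : ℝ) / (A.card : ℝ) else 0) -
        (if i ∈ B then (1 : ℝ) / (B.card : ℝ) else 0)| ≤
      ((A \ B).card : ℝ) + ((B \ A).card : ℝ) := by
  wlog hBA : B.card ≤ A.card generalizing A B
  · have h := this B A (by omega)
    rw [add_comm]
    exact (Finset.sum_congr rfl fun i _ => abs_sub_comm _ _).trans_le h
  have hsplit : ∑ i, |(if i ∈ A then (1 : ℝ) / (A.card : ℝ) else 0) -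
        (if i ∈ B then (1 : ℝ) / (B.card : ℝ) else 0)| =
      (A \ B).card * (1 / (A.card : ℝ)) + (B \ A).card * (1 / (B.card : ℝ)) +
        (A ∩ B).card * |1 / (A.card : ℝ) - 1 / (B.card : ℝ)| := by
    simp_rw [← nsmul_eq_mul, ← Finset.sum_const]
    rw [← Finset.sum_ite_mem_eq (A \ B), ← Finset.sum_ite_mem_eq (B \ A),
      ← Finset.sum_ite_mem_eq (A ∩ B), ← Finset.sum_add_distrib, ← Finset.sum_add_distrib]
    refine Finset.sum_congr rfl fun i _ => ?_
    by_cases hiA : i ∈ A <;> by_cases hiB : i ∈ B <;> simp [hiA, hiB]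
  have hA : (A.card : ℝ) = (A ∩ B).card + (A \ B).card := by
    exact_mod_cast (Finset.card_inter_add_card_sdiff A B).symm
  have hB : (B.card : ℝ) = (A ∩ B).card + (B \ A).card := by
    rw [Finset.inter_comm]
    exact_mod_cast (Finset.card_inter_add_card_sdiff B A).symm
  have hinv (k : ℕ) : 1 / (k : ℝ) ≤ 1 := by
    simpa using Nat.cast_inv_le_one (α := ℝ) k
  rw [hsplit]
  rcases Nat.eq_zero_or_pos (A ∩ B).card with hc | hc
  · rw [hc]
    have h₁ := mul_le_mul_of_nonneg_left (hinv A.card) (Nat.cast_nonneg (α := ℝ) (A \ B).card)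
    have h₂ := mul_le_mul_of_nonneg_left (hinv B.card) (Nat.cast_nonneg (α := ℝ) (B \ A).card)
    push_cast
    linarith
  · have hBA' : (B.card : ℝ) ≤ A.card := by exact_mod_cast hBA
    have hc' : (1 : ℝ) ≤ (A ∩ B).card := by exact_mod_cast hc
    have hy : (0 : ℝ) ≤ (B \ A).card := Nat.cast_nonneg _
    have hbpos : (0 : ℝ) < B.card := by linarith
    have hapos : (0 : ℝ) < A.card := by linarith
    rw [abs_of_nonpos (sub_nonpos.2 (one_div_le_one_div_of_le hbpos hBA'))]
    have hval : ((A \ B).card : ℝ) * (1 / A.card) + (B \ A).card * (1 / B.card) +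
        (A ∩ B).card * -(1 / (A.card : ℝ) - 1 / B.card) = 2 * (A \ B).card / A.card := by
      have hx : ((A \ B).card : ℝ) = A.card - (A ∩ B).card := by linarith
      have hy : ((B \ A).card : ℝ) = B.card - (A ∩ B).card := by linarith
      rw [hx, hy]
      clear hx hy hA hB
      field_simp
      ring
    rw [hval, div_le_iff₀ hapos]
    rcases Nat.eq_zero_or_pos (A \ B).card with hx | hx
    · rw [hx]
      push_cast
      nlinarith
    · have hx' : (1 : ℝ) ≤ (A \ B).card := by exact_mod_cast hx
      nlinarith [mul_nonneg hy hapos.le]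

/-- Among the fibres of `p` over proper values, at most one contains a given index, so the parts of
them lost in passing to `q` have total size at most the number of disagreements. -/
theorem sum_card_fiber_sdiff_le {ι κ : Type*} [Fintype ι] [DecidableEq ι] [Fintype κ]
    [DecidableEq κ] (p q : ι → Option κ) :
    ∑ j, ((Finset.univ.filter (fun i => p i = some j)) \
        (Finset.univ.filter (fun i => q i = some j))).card ≤
      (Finset.univ.filter (fun i => p i ≠ q i)).card := by
  rw [← Finset.card_biUnion]
  · refine Finset.card_le_card fun i hi => ?_
    simp only [Finset.mem_biUnion, Finset.mem_sdiff, Finset.mem_filter, Finset.mem_univ,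
      true_and] at hi ⊢
    obtain ⟨j, h₁, h₂⟩ := hi
    exact fun h => h₂ (h ▸ h₁)
  · intro j _ k _ hjk
    refine Finset.disjoint_left.2 fun i hi hk => hjk ?_
    simp only [Finset.mem_sdiff, Finset.mem_filter, Finset.mem_univ, true_and] at hi hk
    exact Option.some_injective _ (hi.1.symm.trans hk.1)



/-- Deterministic core of the rounding-stability lemma for the maximum weight
bipartite matching algorithm: the total ℓ₁ change of the conditional selection
probabilities `1/|C(j)|` is at most twice the number of indices where the
candidate assignments `p` and `p'` differ. -/
theorem rounding_probabilities_stability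
    (n m : ℕ) (p p' : Fin n → Option (Fin m)) :
    ∑ i : Fin n, ∑ j : Fin m,
      |(if p i = some j then
          (1 : ℝ) / ((Finset.univ.filter (fun i' : Fin n => p i' = some j)).card : ℝ)
        else 0)
       - (if p' i = some j then
          (1 : ℝ) / ((Finset.univ.filter (fun i' : Fin n => p' i' = some j)).card : ℝ)
        else 0)|
    ≤ 2 * ((Finset.univ.filter (fun i : Fin n => p i ≠ p' i)).card : ℝ) := by
  rw [Finset.sum_comm]
  have hle := Finset.sum_le_sum fun (j : Fin m) (_ : j ∈ Finset.univ) =>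
    sum_abs_uniform_sub_uniform_le (Finset.univ.filter fun i => p i = some j)
      (Finset.univ.filter fun i => p' i = some j)
  simp only [Finset.mem_filter, Finset.mem_univ, true_and] at hle
  refine hle.trans ?_
  rw [Finset.sum_add_distrib, two_mul]
  refine add_le_add (by exact_mod_cast sum_card_fiber_sdiff_le p p') ?_
  simp_rw [ne_comm (a := p _)]
  exact_mod_cast sum_card_fiber_sdiff_le p' p
end
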